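/- For 1 ≤ p ≤ n define the operator E_{p,p} on F_N(S) by E_{p,p} := Σ_{k=1}^{m} Σ_{r∈S} :psi_k^p(−r) psibar_k^p(r): − ε·m·Id. Then for every 1 ≤ l ≤ n: E_{p,p}(A_l|0⟩) = A_l|0⟩ if p ≤ l and E_{p,p}(A_l|0⟩) = 0 if p > l; and E_{p,p}(Abar_l|0⟩) = −Abar_l|0⟩ if p ≥ l and E_{p,p}(Abar_l|0⟩) = 0 if p < l. (Equivalently, A_l|0⟩ is a weight vector for the diagonal Cartan of gl_n of weight (1,…,1,0,…,0) with l ones, and Abar_l|0⟩ is a weight vector of weight (0,…,0,−1,…,−1) with l−1 zeros.) -/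

import Mathlib

noncomputable section

/-- Context for the enlarged Weyl algebra `W_N(S)` with `N = m·n` and
`S = ℤ` (encoded by `sig = 0`) or `S = ℤ + 1/2` (encoded by `sig = 1`).
An element `r ∈ S` is encoded by the unique integer `k` with `r = k + sig/2`,
so that `ε := 1/2 - sig/2` and e.g. `r > 0 ↔ 0 < 2k + sig`.
The data also fixes a generic `q ∈ ℂˣ` together with a square root `sq` of `q`. -/
structure WCtx where
  m : ℕ
  n : ℕ
  hm : 0 < m
  hn : 0 < n
  sig : ℤ
  hsig : sig = 0 ∨ sig = 1
  q : ℂ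
  sq : ℂ
  hsq : sq ^ 2 = q
  hq0 : q ≠ 0
  hqu : ∀ k : ℕ, k ≠ 0 → q ^ k ≠ 1

namespace WCtx

variable (C : WCtx)

/-- `N = m n`. -/
def NN : ℕ := C.m * C.n

/-- Names of the generators of `W_N(S)`: `Sum.inl i` is `ψ_{i+1}` and
`Sum.inr i` is `ψ̄_{i+1}`; the integer `k` encodes the index `r = k + sig/2 ∈ S`. -/
abbrev Gen : Type := (Fin C.NN ⊕ Fin C.NN) × ℤ

/-- The defining relations of the enlarged Weyl algebra `W_N(S)`:
any two `ψ`'s commute, any two `ψ̄`'s commute, and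
`ψ̄_i(k)ψ_j(r) − ψ_j(r)ψ̄_i(k) = δ_{i,j} δ_{k+r,0}`. -/
inductive rel : FreeAlgebra ℂ C.Gen → FreeAlgebra ℂ C.Gen → Prop
  | comm_psi (i j : Fin C.NN) (k l : ℤ) :
      rel (FreeAlgebra.ι ℂ ((Sum.inl i, k) : C.Gen) * FreeAlgebra.ι ℂ ((Sum.inl j, l) : C.Gen))
          (FreeAlgebra.ι ℂ ((Sum.inl j, l) : C.Gen) * FreeAlgebra.ι ℂ ((Sum.inl i, k) : C.Gen))
  | comm_psibar (i j : Fin C.NN) (k l : ℤ) :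
      rel (FreeAlgebra.ι ℂ ((Sum.inr i, k) : C.Gen) * FreeAlgebra.ι ℂ ((Sum.inr j, l) : C.Gen))
          (FreeAlgebra.ι ℂ ((Sum.inr j, l) : C.Gen) * FreeAlgebra.ι ℂ ((Sum.inr i, k) : C.Gen))
  | mixed (i j : Fin C.NN) (k l : ℤ) :
      rel (FreeAlgebra.ι ℂ ((Sum.inr i, k) : C.Gen) * FreeAlgebra.ι ℂ ((Sum.inl j, l) : C.Gen))
          (FreeAlgebra.ι ℂ ((Sum.inl j, l) : C.Gen) * FreeAlgebra.ι ℂ ((Sum.inr i, k) : C.Gen)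
            + (if i = j ∧ k + l + C.sig = 0 then 1 else 0))

/-- The enlarged Weyl algebra `W_N(S)`. -/
def W : Type := RingQuot C.rel

instance : Ring C.W := inferInstanceAs (Ring (RingQuot C.rel))
instance : Algebra ℂ C.W := inferInstanceAs (Algebra ℂ (RingQuot C.rel))

/-- `ψ` with `0`-indexed flat subscript. -/
def psi0 (i : Fin C.NN) (k : ℤ) : C.W :=
  RingQuot.mkAlgHom ℂ C.rel (FreeAlgebra.ι ℂ ((Sum.inl i, k) : C.Gen))

/-- `ψ̄` with `0`-indexed flat subscript. -/
def psibar0 (i : Fin C.NN) (k : ℤ) : C.W :=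
  RingQuot.mkAlgHom ℂ C.rel (FreeAlgebra.ι ℂ ((Sum.inr i, k) : C.Gen))

/-- `ψ_i(r)` with `1`-indexed flat subscript `i ∈ {1,…,N}` (junk value `0` outside). -/
def psiF (i : ℕ) (k : ℤ) : C.W :=
  if h : 1 ≤ i ∧ i ≤ C.NN then C.psi0 ⟨i - 1, by omega⟩ k else 0

/-- `ψ̄_i(r)` with `1`-indexed flat subscript `i ∈ {1,…,N}` (junk value `0` outside). -/
def psibarF (i : ℕ) (k : ℤ) : C.W :=
  if h : 1 ≤ i ∧ i ≤ C.NN then C.psibar0 ⟨i - 1, by omega⟩ k else 0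

/-- `ψ_i^c(r) = ψ_{i+(c-1)m}(r)`, subscript `i ∈ {1,…,m}`, superscript `c ∈ {1,…,n}`. -/
def psiS (i c : ℕ) (k : ℤ) : C.W := C.psiF (i + (c - 1) * C.m) k

/-- `ψ̄_i^c(r) = ψ̄_{i+(c-1)m}(r)`. -/
def psibarS (i c : ℕ) (k : ℤ) : C.W := C.psibarF (i + (c - 1) * C.m) k

/-- The left ideal of `W_N(S)` generated by all `ψ_i(r), ψ̄_i(r)` with `r > 0`,
together with all `ψ̄_i(0)` when `S = ℤ`. -/
def vacIdeal : Submodule C.W C.W :=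
  Submodule.span C.W
    {w : C.W |
      (∃ (i : Fin C.NN) (k : ℤ), 0 < 2 * k + C.sig ∧ (w = C.psi0 i k ∨ w = C.psibar0 i k)) ∨
        (C.sig = 0 ∧ ∃ i : Fin C.NN, w = C.psibar0 i 0)}

/-- The Fock module `F_N(S) = W_N(S)/I`. -/
def F : Type := C.W ⧸ C.vacIdeal

instance : AddCommGroup C.F := inferInstanceAs (AddCommGroup (C.W ⧸ C.vacIdeal))
instance : Module C.W C.F := inferInstanceAs (Module C.W (C.W ⧸ C.vacIdeal))
instance : Module ℂ C.F := inferInstanceAs (Module ℂ (C.W ⧸ C.vacIdeal))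

/-- The vacuum vector `|0⟩ ∈ F_N(S)`. -/
def vac : C.F := Submodule.Quotient.mk (1 : C.W)

/-- Normal ordering `:u(k) v(l):` where `l` encodes the `S`-index of the second factor. -/
def nord (u : C.W) (l : ℤ) (v : C.W) : C.W :=
  if 0 < 2 * l + C.sig then u * v
  else if 2 * l + C.sig = 0 then (2 : ℂ)⁻¹ • (u * v + v * u)
  else v * u

/-- `ε = 0` if `S = ℤ + 1/2`, `ε = 1/2` if `S = ℤ`, as a complex number. -/
def eps : ℂ := (1 - (C.sig : ℂ)) / 2

/-- `ω_S(b)`. -/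
def om (b : ℤ) : ℂ :=
  if b = 0 then 0
  else if C.sig = 0 then (2 : ℂ)⁻¹ * ((C.q ^ b + 1) / (C.q ^ b - 1))
  else C.sq ^ b / (C.q ^ b - 1)

/-- `q^{-b r}` for `r = k + sig/2 ∈ S`. -/
def qp (b k : ℤ) : ℂ := C.sq ^ (-(b * (2 * k + C.sig)))

/-- `q^{b r}` for `r = k + sig/2 ∈ S`. -/
def qpp (b k : ℤ) : ℂ := C.sq ^ (b * (2 * k + C.sig))

/-- `φ^c_{t + sig/2}`; here `t ∈ ℤ` encodes the half-integer index `t + sig/2 = t + 1/2 - ε`.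
Writing `t = (k + sig)m - i` with `1 ≤ i ≤ m`, `k ∈ ℤ`, this is `ψ_i^c(k + sig/2)`. -/
def PhiW (c : ℕ) (t : ℤ) : C.W :=
  C.psiF ((((-t - 1).emod C.m).toNat + 1) + (c - 1) * C.m)
    ((t + (-t - 1).emod C.m + 1) / C.m - C.sig)

/-- `φ̄^c_{t + sig/2}`; writing `t = k·m + i - 1` with `1 ≤ i ≤ m`, `k ∈ ℤ`,
this is `ψ̄_i^c(k + sig/2)`. -/
def PhibarW (c : ℕ) (t : ℤ) : C.W :=
  C.psibarF (((t.emod C.m).toNat + 1) + (c - 1) * C.m) ((t - t.emod C.m) / C.m)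

/-- Determinant of a square matrix with (pairwise commuting) entries in `W_N(S)`. -/
def ncdet {l : ℕ} (M : Fin l → Fin l → C.W) : C.W :=
  ∑ p : Equiv.Perm (Fin l),
    (((Equiv.Perm.sign p : ℤˣ) : ℤ)) • ((List.finRange l).map fun t => M (p t) t).prod

/-- The element `A_l ∈ W_N(S)`, `1 ≤ l ≤ n`. -/
def Adet (l : ℕ) : C.W :=
  C.ncdet fun k t : Fin l => C.PhiW ((k : ℕ) + 1) (-(((t : ℕ) : ℤ) + 1))

/-- The element `Ā_l ∈ W_N(S)`, `1 ≤ l ≤ n`. -/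
def Abar (l : ℕ) : C.W :=
  C.ncdet fun s t : Fin (C.n - l + 1) => C.PhibarW (C.n - (s : ℕ)) (-(((t : ℕ) : ℤ) + 1))

/-- `α(r,a,i) = (a - r + 1/2 - ε)m - i + 1 = (a-k)m - i + 1` for `r = k + sig/2`. -/
def alphaV (k a : ℤ) (i : ℕ) : ℤ := (a - k) * C.m - (i : ℤ) + 1

/-- `β(r,a,j) = (r + a - 1/2 + ε)m + j = (k+a)m + j` for `r = k + sig/2`. -/
def betaV (k a : ℤ) (j : ℕ) : ℤ := (k + a) * C.m + (j : ℤ)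

/-- `Σ_{c=1}^{n} ψ_i^c(a-r) ψ̄_j^c(r)`, where `k` encodes `r`. -/
def Esum (i j : ℕ) (a k : ℤ) : C.W :=
  ∑ c : Fin C.n, C.psiS i ((c : ℕ) + 1) (a - k - C.sig) * C.psibarS j ((c : ℕ) + 1) k

/-- `A_l^{i,j,r}`: `A_l` with the `β(r,0,j)`-th column replaced by
`(φ^1_{α(r,a,i)-1/2-ε}, …, φ^l_{α(r,a,i)-1/2-ε})ᵗ`. -/
def Amod (l : ℕ) (i j : ℕ) (a k : ℤ) : C.W :=
  C.ncdet fun r t : Fin l =>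
    if (((t : ℕ) : ℤ) + 1) = C.betaV k 0 j then C.PhiW ((r : ℕ) + 1) (C.alphaV k a i - 1)
    else C.PhiW ((r : ℕ) + 1) (-(((t : ℕ) : ℤ) + 1))

/-- `Ā_l^{i,j,r}`: `Ā_l` with the `α(r,a,i)`-th column replaced by
`(-φ̄^n_{β(r,0,j)-1/2-ε}, …, -φ̄^l_{β(r,0,j)-1/2-ε})ᵗ`. -/
def Abarmod (l : ℕ) (i j : ℕ) (a k : ℤ) : C.W :=
  C.ncdet fun s t : Fin (C.n - l + 1) =>
    if (((t : ℕ) : ℤ) + 1) = C.alphaV k a i then -C.PhibarW (C.n - (s : ℕ)) (C.betaV k 0 j - 1)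
    else C.PhibarW (C.n - (s : ℕ)) (-(((t : ℕ) : ℤ) + 1))

/-- `l̄₁` for `l = l₁ m + l₂`, `1 ≤ l₂ ≤ m`. -/
def lb1 (l : ℕ) : ℕ :=
  if (l - 1) / C.m % 2 = 0 then ((l - 1) / C.m / 2) * C.m + ((l - 1) % C.m + 1)
  else (((l - 1) / C.m + 1) / 2) * C.m

/-- `l̄₂ = l - l̄₁`. -/
def lb2 (l : ℕ) : ℕ := l - C.lb1 l

/-- The `(k,t)` entry of the matrix defining `B_l`. -/
def Bentry (l : ℕ) (k t : Fin l) : C.W :=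
  if (t : ℕ) + 1 ≤ C.lb1 l then C.PhiW ((k : ℕ) + 1) (-(((t : ℕ) : ℤ) + 1))
  else C.PhibarW (C.n - (k : ℕ)) (-((((t : ℕ) : ℤ) + 1) - (C.lb1 l : ℤ)))

/-- The element `B_l ∈ W_N(S)`, `1 ≤ l ≤ n`. -/
def Bdet (l : ℕ) : C.W := C.ncdet (C.Bentry l)

/-- The element `B̄_{n/2} ∈ W_N(S)` (`n` even): `B_{n/2}` with its `(n/2)`-th row replaced. -/
def Bbar : C.W :=
  C.ncdet fun k t : Fin (C.n / 2) =>
    if (k : ℕ) + 1 = C.n / 2 then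
      (if (t : ℕ) + 1 ≤ C.lb1 (C.n / 2) then C.PhiW (C.n / 2 + 1) (-(((t : ℕ) : ℤ) + 1))
       else C.PhibarW (C.n / 2) (-((((t : ℕ) : ℤ) + 1) - (C.lb1 (C.n / 2) : ℤ))))
    else C.Bentry (C.n / 2) k t

/-- `B_l` with its `pos`-th column replaced by the column `(col 1, …, col l)ᵗ`. -/
def Bcolrep (l : ℕ) (pos : ℤ) (col : ℕ → C.W) : C.W :=
  C.ncdet fun k t : Fin l =>
    if (((t : ℕ) : ℤ) + 1) = pos then col ((k : ℕ) + 1) else C.Bentry l k t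

/-- The operator `T_{i,j}(a,b) = Σ_{r∈S} q^{-br} Σ_{c=1}^n :ψ_i^c(a-r) ψ̄_j^c(r):`. -/
def Top (i j : ℕ) (a b : ℤ) (x : C.F) : C.F :=
  ∑ᶠ k : ℤ, (C.qp b k • ∑ c : Fin C.n,
    C.nord (C.psiS i ((c : ℕ) + 1) (a - k - C.sig)) k (C.psibarS j ((c : ℕ) + 1) k)) • x

/-- The operator `S_{i,j}(c,d) = Σ_{e=1}^n ψ_i^e(c) ψ̄_j^e(d)`. -/
def Sop (i j : ℕ) (c d : ℤ) (x : C.F) : C.F :=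
  (∑ e : Fin C.n, C.psiS i ((e : ℕ) + 1) c * C.psibarS j ((e : ℕ) + 1) d) • x

/-- The operator `E_{p,p} = Σ_{c=1}^m Σ_{r∈S} :ψ_c^p(-r) ψ̄_c^p(r): − ε m`. -/
def Epp (p : ℕ) (x : C.F) : C.F :=
  (∑ᶠ k : ℤ, (∑ c : Fin C.m,
      C.nord (C.psiS ((c : ℕ) + 1) p (-k - C.sig)) k (C.psibarS ((c : ℕ) + 1) p k)) • x)
    - (C.eps * (C.m : ℂ)) • x

/-- The operator `E_i(b) = Σ_{r∈S} q^{-br} Σ_{c=1}^n :ψ_i^c(-r) ψ̄_i^c(r): − n ω_S(b)`. -/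
def Eib (i : ℕ) (b : ℤ) (x : C.F) : C.F :=
  (∑ᶠ k : ℤ, (C.qp b k • ∑ c : Fin C.n,
      C.nord (C.psiS i ((c : ℕ) + 1) (-k - C.sig)) k (C.psibarS i ((c : ℕ) + 1) k)) • x)
    - ((C.n : ℂ) * C.om b) • x

/-- `Σ_{r ∈ J^S_{i,l}} q^{-br}`. -/
def Jsum (i l : ℕ) (b : ℤ) : ℂ :=
  ∑ᶠ k ∈ {k : ℤ | 1 ≤ k * (C.m : ℤ) + (i : ℤ) ∧ k * (C.m : ℤ) + (i : ℤ) ≤ (l : ℤ)}, C.qp b k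

/-- `Σ_{r ∈ J̄^S_{i,l}} q^{-br}`. -/
def Jbarsum (i l : ℕ) (b : ℤ) : ℂ :=
  ∑ᶠ k ∈ {k : ℤ | 1 ≤ -(k * (C.m : ℤ)) - (i : ℤ) + 1 ∧ -(k * (C.m : ℤ)) - (i : ℤ) + 1 ≤ (l : ℤ)},
    C.qp b k

/-- `Σ_{r ∈ J^S_{i,l}} q^{br}`. -/
def JsumP (i l : ℕ) (b : ℤ) : ℂ :=
  ∑ᶠ k ∈ {k : ℤ | 1 ≤ k * (C.m : ℤ) + (i : ℤ) ∧ k * (C.m : ℤ) + (i : ℤ) ≤ (l : ℤ)}, C.qpp b k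

/-- `Σ_{c=1}^m ψ_c^p(-r) ψ̄_c^{p+1}(r)` (no normal ordering), `k` encoding `r ∈ S`. -/
def glRaise (p : ℕ) (k : ℤ) : C.W :=
  ∑ c : Fin C.m, C.psiS ((c : ℕ) + 1) p (-k - C.sig) * C.psibarS ((c : ℕ) + 1) (p + 1) k

/-- The operator `Σ_{c=1}^m Σ_{r∈S} :ψ_c^p(-r) ψ̄_c^{p+1}(r):`. -/
def glRaiseOp (p : ℕ) (x : C.F) : C.F :=
  ∑ᶠ k : ℤ, (∑ c : Fin C.m,
    C.nord (C.psiS ((c : ℕ) + 1) p (-k - C.sig)) k (C.psibarS ((c : ℕ) + 1) (p + 1) k)) • x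

end WCtx

namespace WCtx

variable (C : WCtx)

instance : IsScalarTower ℂ C.W C.F :=
  inferInstanceAs (IsScalarTower ℂ C.W (C.W ⧸ C.vacIdeal))

instance : SMulCommClass ℂ C.W C.F := IsScalarTower.to_smulCommClass

theorem psi0_comm (i j : Fin C.NN) (k l : ℤ) :
    C.psi0 i k * C.psi0 j l = C.psi0 j l * C.psi0 i k := by
  have h := RingQuot.mkAlgHom_rel ℂ (rel.comm_psi (C := C) i j k l)
  rw [map_mul, map_mul] at h
  exact h

theorem psibar0_comm (i j : Fin C.NN) (k l : ℤ) :
    C.psibar0 i k * C.psibar0 j l = C.psibar0 j l * C.psibar0 i k := by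
  have h := RingQuot.mkAlgHom_rel ℂ (rel.comm_psibar (C := C) i j k l)
  rw [map_mul, map_mul] at h
  exact h

theorem psibar0_mul_psi0 (i j : Fin C.NN) (k l : ℤ) :
    C.psibar0 i k * C.psi0 j l
      = C.psi0 j l * C.psibar0 i k + if i = j ∧ k + l + C.sig = 0 then 1 else 0 := by
  have h := RingQuot.mkAlgHom_rel ℂ (rel.mixed (C := C) i j k l)
  rw [map_mul, map_add, map_mul, apply_ite (RingQuot.mkAlgHom ℂ C.rel), map_one, map_zero] at h
  exact h

theorem psiF_comm (i j : ℕ) (k l : ℤ) :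
    C.psiF i k * C.psiF j l = C.psiF j l * C.psiF i k := by
  unfold psiF
  split_ifs <;> simp [psi0_comm]

theorem psibarF_comm (i j : ℕ) (k l : ℤ) :
    C.psibarF i k * C.psibarF j l = C.psibarF j l * C.psibarF i k := by
  unfold psibarF
  split_ifs <;> simp [psibar0_comm]

theorem psibarF_mul_psiF {i j : ℕ} (hi : 1 ≤ i ∧ i ≤ C.NN) (hj : 1 ≤ j ∧ j ≤ C.NN) (k l : ℤ) :
    C.psibarF i k * C.psiF j l
      = C.psiF j l * C.psibarF i k + if i = j ∧ k + l + C.sig = 0 then 1 else 0 := by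
  have h : ((⟨i - 1, by omega⟩ : Fin C.NN) = ⟨j - 1, by omega⟩) ↔ i = j := by
    rw [Fin.mk.injEq]; omega
  rw [psibarF, psiF, dif_pos hi, dif_pos hj, psibar0_mul_psi0]
  simp only [h]

/-- The flat index `d + 1 + (c - 1) m` lies in `{1, …, N}`. -/
theorem flat_index_mem {c : ℕ} (hc : 1 ≤ c) (hc' : c ≤ C.n) (d : Fin C.m) :
    1 ≤ (d : ℕ) + 1 + (c - 1) * C.m ∧ (d : ℕ) + 1 + (c - 1) * C.m ≤ C.NN := by
  refine ⟨by omega, ?_⟩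
  obtain ⟨e, rfl⟩ : ∃ e, c = e + 1 := ⟨c - 1, by omega⟩
  have hd := d.2
  have h : C.m * (e + 1) ≤ C.m * C.n := Nat.mul_le_mul_left _ hc'
  unfold NN
  rw [Nat.add_sub_cancel]
  nlinarith

theorem flat_index_inj {c c' : ℕ} (hc : 1 ≤ c) (hc' : 1 ≤ c') (d d' : Fin C.m) :
    (d : ℕ) + 1 + (c - 1) * C.m = (d' : ℕ) + 1 + (c' - 1) * C.m ↔ d = d' ∧ c = c' := by
  constructor
  · intro h
    have h2 : (d : ℕ) + (c - 1) * C.m = (d' : ℕ) + (c' - 1) * C.m := by omega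
    have hm := congrArg (· % C.m) h2
    have hq := congrArg (· / C.m) h2
    simp only [Nat.add_mul_mod_self_right, Nat.mod_eq_of_lt d.2, Nat.mod_eq_of_lt d'.2,
      Nat.add_mul_div_right _ _ C.hm, Nat.div_eq_of_lt d.2, Nat.div_eq_of_lt d'.2] at hm hq
    exact ⟨Fin.ext hm, by omega⟩
  · rintro ⟨rfl, rfl⟩
    rfl

/-- The `k`-th mode of `E_{p,p}`, shifted by a scalar so that it annihilates the vacuum. -/
def mode (p : ℕ) (k : ℤ) : C.W :=
  ∑ c : Fin C.m, (C.psiS ((c : ℕ) + 1) p (-k - C.sig) * C.psibarS ((c : ℕ) + 1) p k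
    + if 2 * k + C.sig < 0 then 1 else 0)

theorem nord_eq {p : ℕ} (hp : 1 ≤ p) (hp' : p ≤ C.n) (k : ℤ) (c : Fin C.m) :
    C.nord (C.psiS ((c : ℕ) + 1) p (-k - C.sig)) k (C.psibarS ((c : ℕ) + 1) p k)
      = C.psiS ((c : ℕ) + 1) p (-k - C.sig) * C.psibarS ((c : ℕ) + 1) p k
        + (if 2 * k + C.sig < 0 then 1 else 0)
        + (if 2 * k + C.sig = 0 then (2 : ℂ)⁻¹ else 0) • (1 : C.W) := by
  have h := C.psibarF_mul_psiF (C.flat_index_mem hp hp' c) (C.flat_index_mem hp hp' c) k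
    (-k - C.sig)
  rw [if_pos ⟨rfl, by ring⟩] at h
  unfold nord psiS psibarS
  rw [h]
  rcases lt_trichotomy (2 * k + C.sig) 0 with h0 | h0 | h0
  · rw [if_neg (by omega), if_neg (by omega), if_pos h0, if_neg (by omega), zero_smul, add_zero]
  · rw [if_neg (by omega), if_pos h0, if_neg (by omega), if_pos h0, ← add_assoc, smul_add,
      ← two_smul ℂ, smul_smul]
    norm_num
  · rw [if_pos h0, if_neg (by omega), if_neg (by omega), zero_smul, add_zero, add_zero]

theorem sum_nord_eq {p : ℕ} (hp : 1 ≤ p) (hp' : p ≤ C.n) (k : ℤ) :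
    ∑ c : Fin C.m, C.nord (C.psiS ((c : ℕ) + 1) p (-k - C.sig)) k (C.psibarS ((c : ℕ) + 1) p k)
      = C.mode p k + (if 2 * k + C.sig = 0 then (2 : ℂ)⁻¹ * C.m else 0) • (1 : C.W) := by
  simp only [C.nord_eq hp hp', Finset.sum_add_distrib, mode]
  congr 1
  rw [Finset.sum_const, Finset.card_univ, Fintype.card_fin, ← Nat.cast_smul_eq_nsmul ℂ, smul_smul,
    mul_ite, mul_zero, mul_comm (C.m : ℂ)]

theorem psiF_smul_vac (i : ℕ) {k : ℤ} (hk : 0 < 2 * k + C.sig) : C.psiF i k • C.vac = 0 := by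
  unfold psiF
  split_ifs with h
  · refine (Submodule.Quotient.mk_eq_zero C.vacIdeal).2 ?_
    change _ * (1 : C.W) ∈ C.vacIdeal
    rw [mul_one]
    exact Submodule.subset_span (Or.inl ⟨_, _, hk, Or.inl rfl⟩)
  · exact zero_smul _ _

theorem psibarF_smul_vac (i : ℕ) {k : ℤ} (hk : 0 ≤ 2 * k + C.sig) :
    C.psibarF i k • C.vac = 0 := by
  unfold psibarF
  split_ifs with h
  · refine (Submodule.Quotient.mk_eq_zero C.vacIdeal).2 ?_
    change _ * (1 : C.W) ∈ C.vacIdeal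
    rw [mul_one]
    rcases hk.lt_or_eq with hk | hk
    · exact Submodule.subset_span (Or.inl ⟨_, _, hk, Or.inr rfl⟩)
    · have hs : C.sig = 0 := by rcases C.hsig with h | h <;> omega
      obtain rfl : k = 0 := by omega
      exact Submodule.subset_span (Or.inr ⟨hs, _, rfl⟩)
  · exact zero_smul _ _

theorem mode_smul_vac {p : ℕ} (hp : 1 ≤ p) (hp' : p ≤ C.n) (k : ℤ) :
    C.mode p k • C.vac = 0 := by
  rw [mode, Finset.sum_smul]
  refine Finset.sum_eq_zero fun c _ => ?_
  split_ifs with hk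
  · have h := C.psibarF_mul_psiF (C.flat_index_mem hp hp' c) (C.flat_index_mem hp hp' c) k
      (-k - C.sig)
    rw [if_pos ⟨rfl, by ring⟩] at h
    rw [psiS, psibarS, ← h, mul_smul, C.psiF_smul_vac _ (by rcases C.hsig with h | h <;> omega),
      smul_zero]
  · rw [add_zero, psibarS, mul_smul, C.psibarF_smul_vac _ (by omega), smul_zero]

theorem mode_mul_psiF {p c : ℕ} (hp : 1 ≤ p) (hp' : p ≤ C.n) (hc : 1 ≤ c) (hc' : c ≤ C.n)
    (d : Fin C.m) (j k : ℤ) :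
    C.mode p k * C.psiF ((d : ℕ) + 1 + (c - 1) * C.m) j
      = C.psiF ((d : ℕ) + 1 + (c - 1) * C.m) j * C.mode p k
        + (if k = -j - C.sig then (if c = p then (1 : ℂ) else 0) else 0) •
          C.psiF ((d : ℕ) + 1 + (c - 1) * C.m) j := by
  have key : ∀ e : Fin C.m,
      (C.psiS ((e : ℕ) + 1) p (-k - C.sig) * C.psibarS ((e : ℕ) + 1) p k
        + if 2 * k + C.sig < 0 then 1 else 0) * C.psiF ((d : ℕ) + 1 + (c - 1) * C.m) j
      = C.psiF ((d : ℕ) + 1 + (c - 1) * C.m) j *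
        (C.psiS ((e : ℕ) + 1) p (-k - C.sig) * C.psibarS ((e : ℕ) + 1) p k
          + if 2 * k + C.sig < 0 then 1 else 0)
        + if e = d then (if k = -j - C.sig then (if c = p then (1 : ℂ) else 0) else 0) •
          C.psiF ((d : ℕ) + 1 + (c - 1) * C.m) j else 0 := by
    intro e
    have h := C.psibarF_mul_psiF (C.flat_index_mem hp hp' e) (C.flat_index_mem hc hc' d) k j
    have hu := C.psiF_comm ((e : ℕ) + 1 + (p - 1) * C.m) ((d : ℕ) + 1 + (c - 1) * C.m)
      (-k - C.sig) j
    simp only [C.flat_index_inj hp hc] at h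
    rw [psiS, psibarS, add_mul, mul_add, mul_assoc, h, mul_add, ← mul_assoc, hu, mul_assoc,
      add_right_comm, mul_ite, ite_mul, one_mul, mul_one, zero_mul, mul_zero,
      mul_ite (2 * k + C.sig < 0), mul_one, mul_zero]
    congr 1
    by_cases h1 : e = d
    · by_cases h2 : p = c
      · by_cases h3 : k = -j - C.sig
        · subst h1 h2 h3
          have : -j - C.sig + j + C.sig = 0 := by ring
          simp [this]
        · have : ¬ (k + j + C.sig = 0) := by omega
          simp [h3, this]
      · simp [h2, Ne.symm h2]
    · simp [h1]
  rw [mode, Finset.sum_mul, Finset.sum_congr rfl fun e _ => key e, Finset.sum_add_distrib,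
    ← Finset.mul_sum, Finset.sum_ite_eq' Finset.univ d]
  simp

theorem mode_mul_psibarF {p c : ℕ} (hp : 1 ≤ p) (hp' : p ≤ C.n) (hc : 1 ≤ c) (hc' : c ≤ C.n)
    (d : Fin C.m) (j k : ℤ) :
    C.mode p k * C.psibarF ((d : ℕ) + 1 + (c - 1) * C.m) j
      = C.psibarF ((d : ℕ) + 1 + (c - 1) * C.m) j * C.mode p k
        + (if k = j then (if c = p then (-1 : ℂ) else 0) else 0) •
          C.psibarF ((d : ℕ) + 1 + (c - 1) * C.m) j := by
  have key : ∀ e : Fin C.m,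
      (C.psiS ((e : ℕ) + 1) p (-k - C.sig) * C.psibarS ((e : ℕ) + 1) p k
        + if 2 * k + C.sig < 0 then 1 else 0) * C.psibarF ((d : ℕ) + 1 + (c - 1) * C.m) j
      = C.psibarF ((d : ℕ) + 1 + (c - 1) * C.m) j *
        (C.psiS ((e : ℕ) + 1) p (-k - C.sig) * C.psibarS ((e : ℕ) + 1) p k
          + if 2 * k + C.sig < 0 then 1 else 0)
        + if e = d then (if k = j then (if c = p then (-1 : ℂ) else 0) else 0) •
          C.psibarF ((d : ℕ) + 1 + (c - 1) * C.m) j else 0 := by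
    intro e
    have h := C.psibarF_mul_psiF (C.flat_index_mem hc hc' d) (C.flat_index_mem hp hp' e) j
      (-k - C.sig)
    have hv := C.psibarF_comm ((e : ℕ) + 1 + (p - 1) * C.m) ((d : ℕ) + 1 + (c - 1) * C.m) k j
    simp only [C.flat_index_inj hc hp] at h
    rw [psiS, psibarS, add_mul, mul_add, mul_assoc, hv, ← mul_assoc, ← mul_assoc, h, add_mul,
      ite_mul (2 * k + C.sig < 0), mul_ite, one_mul, mul_one, zero_mul, mul_zero,
      add_right_comm (_ * _ * _) (_ * _), add_assoc (_ + _) (_ * _), left_eq_add, ite_mul, one_mul,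
      zero_mul]
    by_cases h1 : e = d
    · by_cases h2 : p = c
      · by_cases h3 : k = j
        · subst h1 h2 h3
          have : k + (-k - C.sig) + C.sig = 0 := by ring
          simp [this]
        · have : ¬ (j + (-k - C.sig) + C.sig = 0) := by omega
          simp [h3, this]
      · simp [Ne.symm h2]
    · simp [h1, Ne.symm h1]
  rw [mode, Finset.sum_mul, Finset.sum_congr rfl fun e _ => key e, Finset.sum_add_distrib,
    ← Finset.mul_sum, Finset.sum_ite_eq' Finset.univ d]
  simp

theorem exists_PhiW_eq (c : ℕ) (t : ℤ) :
    ∃ (d : Fin C.m) (j : ℤ), C.PhiW c t = C.psiF ((d : ℕ) + 1 + (c - 1) * C.m) j := by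
  have hm : (0 : ℤ) < C.m := by exact_mod_cast C.hm
  have h0 : 0 ≤ (-t - 1).emod C.m := Int.emod_nonneg _ hm.ne'
  have h1 : (-t - 1).emod C.m < C.m := Int.emod_lt_of_pos _ hm
  exact ⟨⟨((-t - 1).emod C.m).toNat, by omega⟩, _, rfl⟩

theorem exists_PhibarW_eq (c : ℕ) (t : ℤ) :
    ∃ (d : Fin C.m) (j : ℤ), C.PhibarW c t = C.psibarF ((d : ℕ) + 1 + (c - 1) * C.m) j := by
  have hm : (0 : ℤ) < C.m := by exact_mod_cast C.hm
  have h0 : 0 ≤ t.emod C.m := Int.emod_nonneg _ hm.ne'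
  have h1 : t.emod C.m < C.m := Int.emod_lt_of_pos _ hm
  exact ⟨⟨(t.emod C.m).toNat, by omega⟩, _, rfl⟩

/-- `x` has weight `w` for the sum of the modes `C.mode p k`, which is finite on `x`. -/
def HasWeight (p : ℕ) (w : ℂ) (x : C.F) : Prop :=
  (Function.support fun k : ℤ => C.mode p k • x).Finite ∧ ∑ᶠ k : ℤ, C.mode p k • x = w • x

variable {C}

theorem HasWeight.zero (p : ℕ) (w : ℂ) : C.HasWeight p w 0 := by
  simp [HasWeight]

theorem HasWeight.add {p : ℕ} {w : ℂ} {x y : C.F} (hx : C.HasWeight p w x)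
    (hy : C.HasWeight p w y) : C.HasWeight p w (x + y) := by
  unfold HasWeight
  simp only [smul_add]
  refine ⟨(hx.1.union hy.1).subset (Function.support_add _ _), ?_⟩
  rw [finsum_add_distrib hx.1 hy.1, hx.2, hy.2]

theorem HasWeight.zsmul {p : ℕ} {w : ℂ} {x : C.F} (hx : C.HasWeight p w x) (z : ℤ) :
    C.HasWeight p w (z • x) := by
  unfold HasWeight
  simp only [smul_comm _ z]
  refine ⟨hx.1.subset fun k hk h => hk ?_, ?_⟩
  · simp only [h, smul_zero]
  · rw [← smul_finsum' z hx.1, hx.2]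

theorem HasWeight.sum {ι : Type*} {p : ℕ} {w : ℂ} (s : Finset ι) {x : ι → C.F}
    (hx : ∀ i ∈ s, C.HasWeight p w (x i)) : C.HasWeight p w (∑ i ∈ s, x i) :=
  Finset.sum_induction _ _ (fun _ _ => HasWeight.add) (HasWeight.zero p w) hx

/-- `g` shifts weights by `v`, the shift coming from a single mode. -/
def ShiftsWeight (C : WCtx) (p : ℕ) (v : ℂ) (g : C.W) : Prop :=
  ∃ k₀ : ℤ, ∀ k, C.mode p k * g = g * C.mode p k + (if k = k₀ then v else 0) • g

theorem HasWeight.smul {p : ℕ} {w v : ℂ} {x : C.F} (hx : C.HasWeight p w x) {g : C.W}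
    (hg : ShiftsWeight C p v g) : C.HasWeight p (v + w) (g • x) := by
  obtain ⟨k₀, hg⟩ := hg
  have e : ∀ k, C.mode p k • g • x
      = g • C.mode p k • x + if k = k₀ then v • g • x else 0 := by
    intro k
    rw [← mul_smul, hg, add_smul, mul_smul, smul_assoc, ite_smul, zero_smul]
  have h1 : (Function.support fun k : ℤ => g • C.mode p k • x).Finite :=
    hx.1.subset fun k hk h => hk (by simp only [h, smul_zero])
  have h2 : (Function.support fun k : ℤ => if k = k₀ then v • g • x else 0).Finite :=
    (Set.finite_singleton k₀).subset fun k hk => by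
      by_contra h
      exact hk (if_neg h)
  unfold HasWeight
  simp only [e]
  refine ⟨(h1.union h2).subset (Function.support_add _ _), ?_⟩
  rw [finsum_add_distrib h1 h2, ← smul_finsum' g hx.1, hx.2, finsum_eq_single _ k₀ fun k hk =>
    if_neg hk, if_pos rfl, add_smul, add_comm, smul_comm g w x]

theorem HasWeight.list_prod_smul {ι : Type*} {p : ℕ} {w : ℂ} {x : C.F}
    (hx : C.HasWeight p w x) (g : ι → C.W) (v : ι → ℂ)
    (hg : ∀ i, ShiftsWeight C p (v i) (g i)) (L : List ι) :
    C.HasWeight p ((L.map v).sum + w) ((L.map g).prod • x) := by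
  induction L with
  | nil => simpa using hx
  | cons i L ih =>
    simp only [List.map_cons, List.prod_cons, List.sum_cons, mul_smul, add_assoc]
    exact ih.smul (hg i)

theorem HasWeight.ncdet_smul {l p : ℕ} {w : ℂ} {x : C.F} (hx : C.HasWeight p w x)
    (M : Fin l → Fin l → C.W) (v : Fin l → ℂ)
    (hM : ∀ s t, ShiftsWeight C p (v s) (M s t)) :
    C.HasWeight p (∑ s, v s + w) (C.ncdet M • x) := by
  rw [ncdet, Finset.sum_smul]
  refine HasWeight.sum _ fun σ _ => ?_
  rw [smul_assoc]
  refine HasWeight.zsmul ?_ _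
  have h := hx.list_prod_smul (fun t => M (σ t) t) (fun t => v (σ t)) (fun t => hM _ _)
    (List.finRange l)
  rwa [← List.ofFn_eq_map, List.sum_ofFn, Equiv.sum_comp σ v] at h

theorem hasWeight_vac {p : ℕ} (hp : 1 ≤ p) (hp' : p ≤ C.n) : C.HasWeight p 0 C.vac := by
  simp [HasWeight, C.mode_smul_vac hp hp']

theorem HasWeight.Epp_eq {p : ℕ} (hp : 1 ≤ p) (hp' : p ≤ C.n) {w : ℂ} {x : C.F}
    (hx : C.HasWeight p w x) : C.Epp p x = w • x := by
  have e : ∀ k : ℤ, (C.mode p k + (if 2 * k + C.sig = 0 then (2 : ℂ)⁻¹ * C.m else 0) •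
      (1 : C.W)) • x = C.mode p k • x + if k = 0 then (C.eps * C.m) • x else 0 := by
    intro k
    rw [add_smul, smul_assoc, one_smul, ite_smul, zero_smul]
    congr 1
    unfold eps
    rcases C.hsig with h | h <;> rw [h]
    · simp
    · rw [if_neg (by omega)]
      simp
  have h2 : (Function.support fun k : ℤ => if k = 0 then (C.eps * C.m) • x else 0).Finite :=
    (Set.finite_singleton 0).subset fun k hk => by
      by_contra h
      exact hk (if_neg h)
  unfold Epp
  simp only [C.sum_nord_eq hp hp', e]
  rw [finsum_add_distrib hx.1 h2, hx.2, finsum_eq_single _ 0 fun k hk => if_neg hk, if_pos rfl,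
    add_sub_cancel_right]

theorem shiftsWeight_PhiW {p c : ℕ} (hp : 1 ≤ p) (hp' : p ≤ C.n) (hc : 1 ≤ c) (hc' : c ≤ C.n)
    (t : ℤ) : ShiftsWeight C p (if c = p then 1 else 0) (C.PhiW c t) := by
  obtain ⟨d, j, h⟩ := C.exists_PhiW_eq c t
  rw [h]
  exact ⟨_, C.mode_mul_psiF hp hp' hc hc' d j⟩

theorem shiftsWeight_PhibarW {p c : ℕ} (hp : 1 ≤ p) (hp' : p ≤ C.n) (hc : 1 ≤ c) (hc' : c ≤ C.n)
    (t : ℤ) : ShiftsWeight C p (if c = p then -1 else 0) (C.PhibarW c t) := by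
  obtain ⟨d, j, h⟩ := C.exists_PhibarW_eq c t
  rw [h]
  exact ⟨_, C.mode_mul_psibarF hp hp' hc hc' d j⟩

theorem Epp_Adet {p l : ℕ} (hp : 1 ≤ p) (hp' : p ≤ C.n) (hl' : l ≤ C.n) :
    C.Epp p (C.Adet l • C.vac)
      = (∑ s : Fin l, if (s : ℕ) + 1 = p then (1 : ℂ) else 0) • (C.Adet l • C.vac) := by
  have h := (hasWeight_vac hp hp').ncdet_smul
    (fun k t : Fin l => C.PhiW ((k : ℕ) + 1) (-(((t : ℕ) : ℤ) + 1)))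
    (fun s => if (s : ℕ) + 1 = p then (1 : ℂ) else 0)
    (fun s t => shiftsWeight_PhiW hp hp' (by omega) (by omega) _)
  rw [add_zero] at h
  exact h.Epp_eq hp hp'

theorem Epp_Abar {p l : ℕ} (hp : 1 ≤ p) (hp' : p ≤ C.n) (hl : 1 ≤ l) (hl' : l ≤ C.n) :
    C.Epp p (C.Abar l • C.vac)
      = (∑ s : Fin (C.n - l + 1), if C.n - (s : ℕ) = p then (-1 : ℂ) else 0) •
        (C.Abar l • C.vac) := by
  have h := (hasWeight_vac hp hp').ncdet_smul
    (fun s t : Fin (C.n - l + 1) => C.PhibarW (C.n - (s : ℕ)) (-(((t : ℕ) : ℤ) + 1)))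
    (fun s => if C.n - (s : ℕ) = p then (-1 : ℂ) else 0)
    (fun s t => shiftsWeight_PhibarW hp hp' (by omega) (by omega) _)
  rw [add_zero] at h
  exact h.Epp_eq hp hp'

end WCtx

open WCtx in
/-- **Lemma 5.6.**  For `1 ≤ p ≤ n` let
`E_{p,p} = Σ_{c=1}^m Σ_{r∈S} :ψ_c^p(-r)ψ̄_c^p(r): − ε m`.  Then for `1 ≤ l ≤ n`:
`E_{p,p}(A_l|0⟩) = A_l|0⟩` if `p ≤ l` and `= 0` if `p > l`; and
`E_{p,p}(Ā_l|0⟩) = −Ā_l|0⟩` if `p ≥ l` and `= 0` if `p < l`. -/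
theorem statement9 (C : WCtx) (p : ℕ) (hp : 1 ≤ p) (hp' : p ≤ C.n)
    (l : ℕ) (hl : 1 ≤ l) (hl' : l ≤ C.n) :
    (p ≤ l → C.Epp p (C.Adet l • C.vac) = C.Adet l • C.vac)
    ∧ (l < p → C.Epp p (C.Adet l • C.vac) = 0)
    ∧ (l ≤ p → C.Epp p (C.Abar l • C.vac) = -(C.Abar l • C.vac))
    ∧ (p < l → C.Epp p (C.Abar l • C.vac) = 0) := by
  rw [Epp_Adet hp hp' hl', Epp_Abar hp hp' hl hl']
  refine ⟨fun h => ?_, fun h => ?_, fun h => ?_, fun h => ?_⟩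
  · rw [Finset.sum_eq_single (⟨p - 1, by omega⟩ : Fin l), if_pos (by simp only; omega), one_smul]
    · intro s _ hs
      exact if_neg fun h' => hs (Fin.ext (by simp only; omega))
    · simp
  · rw [Finset.sum_eq_zero fun s _ => if_neg (by omega), zero_smul]
  · rw [Finset.sum_eq_single (⟨C.n - p, by omega⟩ : Fin (C.n - l + 1)),
      if_pos (by simp only; omega), neg_one_smul]
    · intro s _ hs
      exact if_neg fun h' => hs (Fin.ext (by simp only; omega))
    · simp
  · rw [Finset.sum_eq_zero fun s _ => if_neg (by omega), zero_smul]
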